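/- Let (B,n) be a two-dimensional Cohen–Macaulay Noetherian local ring with minimal multiplicity, and let P be a prime ideal of B of height one. Set A = B/P, a one-dimensional Cohen–Macaulay local domain. Then for every maximal Cohen–Macaulay A-module M, the Hilbert function of M with respect to the maximal ideal of A is non-decreasing: H(M,n) ≤ H(M,n+1) for all n ≥ 0. -/

import Mathlib

open IsLocalRing

/-- The length of a module, i.e. the Krull dimension of its lattice of submodules. -/
noncomputable def moduleLength (R : Type*) (M : Type*) [CommRing R] [AddCommGroup M]
    [Module R M] : WithBot ℕ∞ :=
  Order.krullDim (Submodule R M)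

/-- The Hilbert function of a module `M` with respect to an ideal `I`:
`n ↦ length (I^n M / I^(n+1) M)`. -/
noncomputable def hilbertFn (R : Type*) (M : Type*) [CommRing R] [AddCommGroup M]
    [Module R M] (I : Ideal R) (n : ℕ) : WithBot ℕ∞ :=
  moduleLength R (↥(I ^ n • (⊤ : Submodule R M)) ⧸
    (Submodule.comap (I ^ n • (⊤ : Submodule R M)).subtype (I ^ (n + 1) • (⊤ : Submodule R M))))

/-- The depth of `M` with respect to the ideal `I`: the supremum of lengths of
`M`-regular sequences consisting of elements of `I`. -/
noncomputable def seqDepth (R : Type*) (M : Type*) [CommRing R] [AddCommGroup M]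
    [Module R M] (I : Ideal R) : ℕ∞ :=
  sSup {n : ℕ∞ | ∃ rs : List R, (rs.length : ℕ∞) = n ∧ (∀ x ∈ rs, x ∈ I) ∧
    RingTheory.Sequence.IsRegular M rs}

/-- A `d`-dimensional Cohen–Macaulay local ring has minimal multiplicity if there is a
system of parameters `x₁, …, x_d` with `𝔫² = (x₁, …, x_d)·𝔫`. -/
def HasMinimalMultiplicity (R : Type*) [CommRing R] [IsLocalRing R] (d : ℕ) : Prop :=
  ∃ x : Fin d → R, (∀ i, x i ∈ maximalIdeal R) ∧
    (maximalIdeal R) ^ 2 = Ideal.span (Set.range x) * maximalIdeal R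

/-- Length of quotients is additive along a chain `N' ≤ N` of submodules. -/
lemma length_quotient_eq_add {R M : Type*} [CommRing R] [AddCommGroup M] [Module R M]
    {N' N : Submodule R M} (h : N' ≤ N) :
    Module.length R (M ⧸ N') =
      Module.length R (↥N ⧸ N'.comap N.subtype) + Module.length R (M ⧸ N) := by
  refine Module.length_eq_add_of_exact
    (Submodule.mapQ (N'.comap N.subtype) N' N.subtype le_rfl) (Submodule.factor h) ?_
    (Submodule.factor_surjective h) ?_
  · rw [← LinearMap.ker_eq_bot, Submodule.ker_mapQ, Submodule.mkQ_map_self]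
  · rw [LinearMap.exact_iff, Submodule.range_mapQ, Submodule.range_subtype, Submodule.factor,
      Submodule.ker_mapQ, Submodule.comap_id]

/-- For an `M`-regular element `x`, `ℓ(M / xN) = ℓ(M / N) + ℓ(M / xM)`. -/
lemma length_quotient_map_lsmul {R M : Type*} [CommRing R] [AddCommGroup M] [Module R M]
    {x : R} (hx : IsSMulRegular M x) (N : Submodule R M) :
    Module.length R (M ⧸ N.map (LinearMap.lsmul R M x)) =
      Module.length R (M ⧸ N) +
        Module.length R (M ⧸ LinearMap.range (LinearMap.lsmul R M x)) := by
  have hinj : Function.Injective (LinearMap.lsmul R M x) := hx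
  refine Module.length_eq_add_of_exact
    (Submodule.mapQ N (N.map (LinearMap.lsmul R M x)) (LinearMap.lsmul R M x)
      (Submodule.le_comap_map _ _))
    (Submodule.factor LinearMap.map_le_range) ?_ (Submodule.factor_surjective _) ?_
  · rw [← LinearMap.ker_eq_bot, Submodule.ker_mapQ, Submodule.comap_map_eq_of_injective hinj,
      Submodule.mkQ_map_self]
  · rw [LinearMap.exact_iff, Submodule.range_mapQ, Submodule.factor,
      Submodule.ker_mapQ, Submodule.comap_id]

/-- A finite module over a one-dimensional Noetherian ring has finite length modulo a submodule
containing `c M` for a nonzerodivisor `c`. -/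
lemma length_quotient_ne_top_of_smul_mem {R M : Type*} [CommRing R] [IsNoetherianRing R]
    [Ring.KrullDimLE 1 R] [AddCommGroup M] [Module R M] [Module.Finite R M]
    {c : R} (hc : c ∈ nonZeroDivisors R) {N : Submodule R M} (hN : ∀ m : M, c • m ∈ N) :
    Module.length R (M ⧸ N) ≠ ⊤ := by
  have hA := (isFiniteLength_iff_isNoetherian_isArtinian.mp
    (isFiniteLength_quotient_span_singleton R hc)).2
  have htor : Module.IsTorsionBySet R (M ⧸ N) (Ideal.span {c} : Ideal R) := by
    rw [Module.isTorsionBySet_span_singleton_iff]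
    intro m
    obtain ⟨m, rfl⟩ := N.mkQ_surjective m
    exact (Submodule.Quotient.mk_eq_zero N).mpr (hN m)
  let := htor.module
  have : IsArtinianRing (R ⧸ Ideal.span {c}) := isArtinian_of_tower R hA
  have : Module.Finite (R ⧸ Ideal.span {c}) (M ⧸ N) := Module.Finite.of_restrictScalars_finite R _ _
  have : IsArtinian R (M ⧸ N) :=
    isArtinian_of_surjective_algebraMap (R := R ⧸ Ideal.span {c}) Ideal.Quotient.mk_surjective
  exact Module.length_ne_top

/-- If `I² ⊆ (x, y) I` with `x ∈ I` regular on `M`, then the Hilbert function of `M` with respect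
to `I` is non-decreasing, provided `M / xM` and all the `M / Iᵏ M` have finite length. -/
lemma hilbertFn_le_succ {R M : Type*} [CommRing R] [AddCommGroup M] [Module R M] {I : Ideal R}
    {x y : R} (hxI : x ∈ I) (hyI : y ∈ I) (hI : I ^ 2 ≤ Ideal.span {x, y} * I)
    (hx : IsSMulRegular M x)
    (hfin : ∀ k : ℕ, Module.length R (M ⧸ (I ^ k • (⊤ : Submodule R M))) ≠ ⊤)
    (hE : Module.length R (M ⧸ LinearMap.range (LinearMap.lsmul R M x)) ≠ ⊤) (n : ℕ) :
    hilbertFn R M I n ≤ hilbertFn R M I (n + 1) := by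
  set F : ℕ → Submodule R M := fun k => I ^ k • ⊤ with hF
  set X := LinearMap.lsmul R M x with hX
  set Y := LinearMap.lsmul R M y with hY
  have smul_mem {z : R} (hz : z ∈ I) {k : ℕ} {m : M} (hm : m ∈ F k) : z • m ∈ F (k + 1) := by
    simp only [hF, pow_succ', mul_smul]
    exact Submodule.smul_mem_smul hz hm
  have hanti (k : ℕ) : F (k + 1) ≤ F k :=
    Submodule.smul_mono_left (Ideal.pow_le_pow_right k.le_succ)
  have hXF (k : ℕ) : (F k).map X ≤ F (k + 1) := by
    rintro _ ⟨m, hm, rfl⟩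
    exact smul_mem hxI hm
  have hgen (k : ℕ) : F (k + 2) ≤ (F (k + 1)).map X ⊔ (F (k + 1)).map Y := by
    have h1 : I ^ (k + 2) ≤ Ideal.span {x, y} * I ^ (k + 1) := by
      calc I ^ (k + 2) = I ^ 2 * I ^ k := by ring
        _ ≤ Ideal.span {x, y} * I * I ^ k := Ideal.mul_mono_left hI
        _ = _ := by ring
    refine (Submodule.smul_mono_left h1).trans ?_
    rw [mul_smul, Submodule.smul_le]
    intro r hr m hm
    obtain ⟨a, b, rfl⟩ := Ideal.mem_span_pair.mp hr
    rw [add_smul, mul_comm a, mul_comm b, mul_smul, mul_smul]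
    exact Submodule.add_mem_sup ⟨a • m, Submodule.smul_mem _ _ hm, rfl⟩
      ⟨b • m, Submodule.smul_mem _ _ hm, rfl⟩
  have hH (k : ℕ) : hilbertFn R M I k =
      (Module.length R (↥(F k) ⧸ (F (k + 1)).comap (F k).subtype) : WithBot ℕ∞) :=
    (Module.coe_length ..).symm
  have hq : Module.length R (↥(F (n + 2)) ⧸ ((F (n + 1)).map X).comap (F (n + 2)).subtype) ≤
      Module.length R (↥(F (n + 1)) ⧸ ((F n).map X).comap (F (n + 1)).subtype) := by
    let Y' : ↥(F (n + 1)) →ₗ[R] ↥(F (n + 2)) := Y.restrict fun m hm => smul_mem hyI hm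
    refine Module.length_le_of_surjective (Submodule.mapQ _ _ Y' ?_) ?_
    · rintro ⟨_, _⟩ ⟨m, hm, rfl⟩
      exact ⟨y • m, smul_mem hyI hm, smul_comm x y m⟩
    · intro q
      obtain ⟨⟨m, hm⟩, rfl⟩ := Submodule.mkQ_surjective _ q
      obtain ⟨_, ⟨a, ha, rfl⟩, _, ⟨b, hb, rfl⟩, hab⟩ := Submodule.mem_sup.mp (hgen n hm)
      refine ⟨Submodule.Quotient.mk ⟨b, hb⟩, ?_⟩
      rw [Submodule.mapQ_apply, Submodule.mkQ_apply, eq_comm, Submodule.Quotient.eq]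
      refine ⟨a, ha, ?_⟩
      rw [← sub_eq_iff_eq_add.mpr hab.symm]
      rfl
  rw [hH, hH, WithBot.coe_le_coe]
  have a0 := length_quotient_eq_add (hanti n)
  have a1 := length_quotient_eq_add (hanti (n + 1))
  have b0 := (length_quotient_map_lsmul hx (F n)).symm.trans (length_quotient_eq_add (hXF n))
  have b1 := (length_quotient_map_lsmul hx (F (n + 1))).symm.trans
    (length_quotient_eq_add (hXF (n + 1)))
  have f0 : Module.length R (M ⧸ F n) ≠ ⊤ := hfin n
  have f1 : Module.length R (M ⧸ F (n + 1)) ≠ ⊤ := hfin (n + 1)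
  have f2 : Module.length R (M ⧸ F (n + 1 + 1)) ≠ ⊤ := hfin (n + 2)
  change Module.length R (↥(F (n + 1 + 1)) ⧸ _) ≤ _ at hq
  generalize Module.length R (M ⧸ F n) = l0 at *
  generalize Module.length R (M ⧸ F (n + 1)) = l1 at *
  generalize Module.length R (M ⧸ F (n + 1 + 1)) = l2 at *
  generalize Module.length R (M ⧸ LinearMap.range (LinearMap.lsmul R M x)) = e at *
  generalize Module.length R (↥(F n) ⧸ (F (n + 1)).comap (F n).subtype) = h0 at *
  generalize Module.length R (↥(F (n + 1)) ⧸ (F (n + 1 + 1)).comap (F (n + 1)).subtype) = h1 at *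
  generalize Module.length R (↥(F (n + 1)) ⧸ ((F n).map X).comap (F (n + 1)).subtype) = q0 at *
  generalize Module.length R
    (↥(F (n + 1 + 1)) ⧸ ((F (n + 1)).map X).comap (F (n + 1 + 1)).subtype) = q1 at *
  have hh0 : h0 ≠ ⊤ := ne_top_of_le_ne_top f1 (a0 ▸ le_self_add)
  have hh1 : h1 ≠ ⊤ := ne_top_of_le_ne_top f2 (a1 ▸ le_self_add)
  have hq0 : q0 ≠ ⊤ := ne_top_of_le_ne_top (WithTop.add_ne_top.mpr ⟨f0, hE⟩) (b0.symm ▸ le_self_add)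
  have hq1 : q1 ≠ ⊤ := ne_top_of_le_ne_top hq0 hq
  lift l0 to ℕ using f0
  lift l1 to ℕ using f1
  lift l2 to ℕ using f2
  lift e to ℕ using hE
  lift h0 to ℕ using hh0
  lift h1 to ℕ using hh1
  lift q0 to ℕ using hq0
  lift q1 to ℕ using hq1
  norm_cast at *
  omega

/-- Positive depth provides a regular element. -/
lemma exists_isSMulRegular_of_seqDepth_eq_one {R M : Type*} [CommRing R] [AddCommGroup M]
    [Module R M] {I : Ideal R} (h : seqDepth R M I = 1) : ∃ z ∈ I, IsSMulRegular M z := by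
  by_contra! hno
  have : seqDepth R M I ≤ 0 := by
    refine sSup_le ?_
    rintro _ ⟨rs, rfl, hI, hreg⟩
    cases rs with
    | nil => simp
    | cons r rs =>
      exact absurd ((RingTheory.Sequence.isRegular_cons_iff M r rs).mp hreg).1
        (hno r (hI r (by simp)))
  simp [h] at this

/-- The depth of a one-dimensional Noetherian local domain is one. -/
lemma seqDepth_self_eq_one {A : Type*} [CommRing A] [IsNoetherianRing A] [IsLocalRing A]
    [IsDomain A] (hdim : ringKrullDim A = 1) {x : A} (hx : x ∈ maximalIdeal A) (hx0 : x ≠ 0) :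
    seqDepth A A (maximalIdeal A) = 1 := by
  refine le_antisymm (sSup_le ?_) (le_sSup ⟨[x], by simp, by simpa using hx, ?_⟩)
  · rintro _ ⟨rs, rfl, -, hreg⟩
    have h := ringKrullDim_add_length_eq_ringKrullDim_of_isRegular rs hreg
    have : Nontrivial (A ⧸ Ideal.ofList rs) :=
      Ideal.Quotient.nontrivial_iff.mpr fun h => hreg.top_ne_smul (by simp [h])
    have h0 : 0 ≤ ringKrullDim (A ⧸ Ideal.ofList rs) := ringKrullDim_nonneg_of_nontrivial
    have h1 : (rs.length : WithBot ℕ∞) ≤ 1 := by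
      rw [← hdim, ← h]
      exact le_add_of_nonneg_left h0
    exact_mod_cast h1
  · rw [RingTheory.Sequence.isRegular_cons_iff]
    refine ⟨IsSMulRegular.of_ne_zero hx0, ?_⟩
    have : Nontrivial (QuotSMulTop x A) := by
      refine Submodule.Quotient.nontrivial_iff.mpr fun h => ?_
      rw [← Submodule.ideal_span_singleton_smul, smul_eq_mul, Ideal.mul_top,
        Ideal.span_singleton_eq_top] at h
      exact hx h
    exact RingTheory.Sequence.IsRegular.nil _ _

/-- In a Noetherian local domain of dimension at most one, every nonzero principal ideal contains
a power of the maximal ideal. -/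
lemma exists_maximalIdeal_pow_le_span_singleton {A : Type*} [CommRing A] [IsNoetherianRing A]
    [IsLocalRing A] [IsDomain A] [Ring.KrullDimLE 1 A] {x : A} (hx0 : x ≠ 0) :
    ∃ k, maximalIdeal A ^ k ≤ Ideal.span {x} := by
  have hA := (isFiniteLength_iff_isNoetherian_isArtinian.mp
    (isFiniteLength_quotient_span_singleton A (mem_nonZeroDivisors_of_ne_zero hx0))).2
  have : IsArtinianRing (A ⧸ Ideal.span {x}) := isArtinian_of_tower A hA
  exact exists_maximalIdeal_pow_le_of_isArtinianRing_quotient _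

/-- Over a one-dimensional Noetherian local domain with `𝔪² ⊆ (x, y) 𝔪` and `x ≠ 0`, maximal
Cohen–Macaulay modules have non-decreasing Hilbert function. -/
lemma hilbertFn_le_succ_of_seqDepth_eq_one {A M : Type*} [CommRing A] [IsNoetherianRing A]
    [IsLocalRing A] [IsDomain A] [Ring.KrullDimLE 1 A] [AddCommGroup M] [Module A M]
    [Module.Finite A M] {x y : A} (hx : x ∈ maximalIdeal A) (hy : y ∈ maximalIdeal A)
    (hx0 : x ≠ 0) (hI : maximalIdeal A ^ 2 ≤ Ideal.span {x, y} * maximalIdeal A)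
    (hM : seqDepth A M (maximalIdeal A) = 1) (n : ℕ) :
    hilbertFn A M (maximalIdeal A) n ≤ hilbertFn A M (maximalIdeal A) (n + 1) := by
  obtain ⟨z, hz, hzreg⟩ := exists_isSMulRegular_of_seqDepth_eq_one hM
  obtain ⟨k, hk⟩ := exists_maximalIdeal_pow_le_span_singleton hx0
  obtain ⟨a, ha⟩ := Ideal.mem_span_singleton'.mp (hk (Ideal.pow_mem_pow hz k))
  have hxreg : IsSMulRegular M x := .of_mul (a := a) (by rw [ha]; exact hzreg.pow k)
  refine hilbertFn_le_succ hx hy hI hxreg (fun j => ?_) ?_ n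
  · exact length_quotient_ne_top_of_smul_mem
      (mem_nonZeroDivisors_of_ne_zero (pow_ne_zero j hx0))
      fun m => Submodule.smul_mem_smul (Ideal.pow_mem_pow hx j) trivial
  · exact length_quotient_ne_top_of_smul_mem (mem_nonZeroDivisors_of_ne_zero hx0)
      fun m => ⟨m, rfl⟩

/-- `dim B/P + ht P ≤ dim B`. -/
lemma ringKrullDim_quotient_add_height_le {B : Type*} [CommRing B] (p : PrimeSpectrum B) :
    ringKrullDim (B ⧸ p.asIdeal) + Order.height p ≤ ringKrullDim B := by
  have h : ringKrullDim (B ⧸ p.asIdeal) = Order.coheight p := by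
    rw [ringKrullDim_quotient, Order.coheight_eq_krullDim_Ici]
    rfl
  have : Nonempty (PrimeSpectrum B) := ⟨p⟩
  rw [h, ringKrullDim, Order.krullDim_eq_iSup_height_add_coheight_of_nonempty, add_comm]
  exact_mod_cast le_iSup (fun a : PrimeSpectrum B => Order.height a + Order.coheight a) p

/-- Let `(B,𝔫)` be a two-dimensional Cohen–Macaulay Noetherian local ring with minimal
multiplicity and let `P` be a height-one prime of `B`.  Then `A = B/P` is a one-dimensional
Cohen–Macaulay local domain and the Hilbert function of every maximal Cohen–Macaulay
`A`-module is non-decreasing. -/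
theorem hilbert_monotone_of_quotient_by_height_one_prime.{u}
    (B : Type u) [CommRing B] [IsNoetherianRing B] [IsLocalRing B]
    (hdimB : ringKrullDim B = 2)
    (hdepthB : seqDepth B B (maximalIdeal B) = 2)
    (hminmult : HasMinimalMultiplicity B 2)
    (P : Ideal B) (hP : P.IsPrime)
    (hht : Order.height (⟨P, hP⟩ : PrimeSpectrum B) = 1) :
    ∃ _ : IsLocalRing (B ⧸ P),
      IsDomain (B ⧸ P) ∧
      ringKrullDim (B ⧸ P) = 1 ∧
      seqDepth (B ⧸ P) (B ⧸ P) (maximalIdeal (B ⧸ P)) = 1 ∧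
      ∀ (M : Type u) [AddCommGroup M] [Module (B ⧸ P) M]
        [Module.Finite (B ⧸ P) M], Nontrivial M →
        seqDepth (B ⧸ P) M (maximalIdeal (B ⧸ P)) = 1 →
        ∀ n : ℕ, hilbertFn (B ⧸ P) M (maximalIdeal (B ⧸ P)) n ≤
          hilbertFn (B ⧸ P) M (maximalIdeal (B ⧸ P)) (n + 1) := by
  have hloc : IsLocalRing (B ⧸ P) :=
    .of_surjective' (Ideal.Quotient.mk P) Ideal.Quotient.mk_surjective
  have hdom : IsDomain (B ⧸ P) := Ideal.Quotient.isDomain P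
  have hmap : (maximalIdeal B).map (Ideal.Quotient.mk P) = maximalIdeal (B ⧸ P) :=
    map_maximalIdeal_of_surjective _ Ideal.Quotient.mk_surjective
  have hPne : P ≠ maximalIdeal B := by
    rintro rfl
    have h := maximalIdeal_height_eq_ringKrullDim (R := B)
    rw [hdimB, PrimeSpectrum.height_eq_orderHeight ⟨maximalIdeal B, hP⟩, hht] at h
    exact absurd h (by decide)
  obtain ⟨x, hx, hxx⟩ := hminmult
  have hxA (i : Fin 2) : Ideal.Quotient.mk P (x i) ∈ maximalIdeal (B ⧸ P) :=
    hmap ▸ Ideal.mem_map_of_mem _ (hx i)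
  have hIA : maximalIdeal (B ⧸ P) ^ 2 ≤
      Ideal.span {Ideal.Quotient.mk P (x 0), Ideal.Quotient.mk P (x 1)} * maximalIdeal (B ⧸ P) := by
    rw [← hmap, ← Ideal.map_pow, hxx, Ideal.map_mul, Ideal.map_span, ← Set.range_comp]
    refine Ideal.mul_mono_left (Ideal.span_mono ?_)
    rintro _ ⟨i, rfl⟩
    fin_cases i <;> simp
  obtain ⟨u, v, hu, hv, hu0, hI⟩ : ∃ u v : B ⧸ P, u ∈ maximalIdeal (B ⧸ P) ∧
      v ∈ maximalIdeal (B ⧸ P) ∧ u ≠ 0 ∧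
      maximalIdeal (B ⧸ P) ^ 2 ≤ Ideal.span {u, v} * maximalIdeal (B ⧸ P) := by
    by_cases h0 : Ideal.Quotient.mk P (x 0) = 0
    · refine ⟨_, _, hxA 1, hxA 0, fun h1 => hPne ?_, by rwa [Set.pair_comm]⟩
      refine le_antisymm (le_maximalIdeal hP.ne_top) (hP.le_of_pow_le (n := 2) ?_)
      rw [hxx]
      refine Ideal.mul_le_left.trans (Ideal.span_le.mpr ?_)
      rintro _ ⟨i, rfl⟩
      fin_cases i
      · exact Ideal.Quotient.eq_zero_iff_mem.mp h0
      · exact Ideal.Quotient.eq_zero_iff_mem.mp h1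
    · exact ⟨_, _, hxA 0, hxA 1, h0, hIA⟩
  have hle : ringKrullDim (B ⧸ P) ≤ 1 := by
    have h := ringKrullDim_quotient_add_height_le (⟨P, hP⟩ : PrimeSpectrum B)
    rw [hht, hdimB] at h
    rw [← ENat.WithBot.add_le_add_one_right_iff]
    exact h
  have hdim : ringKrullDim (B ⧸ P) = 1 := by
    refine le_antisymm hle ?_
    have : Nontrivial ((B ⧸ P) ⧸ Ideal.span {u}) :=
      Ideal.Quotient.nontrivial_iff.mpr fun h => hu (Ideal.span_singleton_eq_top.mp h)
    rw [← ringKrullDim_quotient_span_singleton_succ_eq_ringKrullDim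
      (IsSMulRegular.of_ne_zero hu0) hu]
    exact le_add_of_nonneg_left ringKrullDim_nonneg_of_nontrivial
  have : Ring.KrullDimLE 1 (B ⧸ P) := (Order.krullDimLE_iff 1 _).mpr hle
  exact ⟨hloc, hdom, hdim, seqDepth_self_eq_one hdim hu hu0,
    fun M _ _ _ _ hM n => hilbertFn_le_succ_of_seqDepth_eq_one hu hv hu0 hI hM n⟩
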